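/- Let V and W be nonzero complex vector spaces equipped with nondegenerate Hermitian sesquilinear forms h₁ and h₂ respectively. If h₁(v, v) · h₂(w, w) ≥ 0 for all v ∈ V and w ∈ W (these diagonal values being real since the forms are Hermitian), then either h₁ and h₂ are both positive definite, or −h₁ and −h₂ are both positive definite. -/

import Mathlib

open scoped ComplexConjugate ComplexOrder

/-- A sesquilinear form on a complex vector space: additive in each variable,
conjugate-linear in the first variable and linear in the second. -/
structure IsSesq {V : Type*} [AddCommGroup V] [Module ℂ V] (h : V → V → ℂ) : Prop where
  add_left : ∀ v v' w : V, h (v + v') w = h v w + h v' w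
  add_right : ∀ v w w' : V, h v (w + w') = h v w + h v w'
  smul_left : ∀ (c : ℂ) (v w : V), h (c • v) w = conj c * h v w
  smul_right : ∀ (c : ℂ) (v w : V), h v (c • w) = c * h v w

/-- The negative of a sesquilinear form is sesquilinear. -/
theorem IsSesq.neg {V : Type*} [AddCommGroup V] [Module ℂ V] {h : V → V → ℂ}
    (hs : IsSesq h) : IsSesq (fun v w => -h v w) where
  add_left v v' w := by rw [hs.add_left]; ring
  add_right v w w' := by rw [hs.add_right]; ring
  smul_left c v w := by rw [hs.smul_left]; ring
  smul_right c v w := by rw [hs.smul_right]; ring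

/-- An isotropic vector of a positive semidefinite Hermitian form lies in its radical. -/
theorem IsSesq.eq_zero_of_diag_eq_zero {V : Type*} [AddCommGroup V] [Module ℂ V]
    {h : V → V → ℂ} (hs : IsSesq h) (hherm : ∀ v w : V, h w v = conj (h v w))
    (hnonneg : ∀ v : V, 0 ≤ h v v) {v : V} (hv : h v v = 0) (w : V) : h v w = 0 := by
  by_contra ha
  have hpos : 0 < Complex.normSq (h v w) := Complex.normSq_pos.mpr ha
  have expand : ∀ t : ℝ, h (w + ((t : ℂ) * h v w) • v) (w + ((t : ℂ) * h v w) • v) =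
      h w w + ((2 * t * Complex.normSq (h v w) : ℝ) : ℂ) := by
    intro t
    rw [hs.add_left, hs.add_right, hs.add_right, hs.smul_left, hs.smul_left,
      hs.smul_right, hs.smul_right, hv, hherm v w]
    push_cast
    rw [Complex.normSq_eq_conj_mul_self, map_mul, Complex.conj_ofReal]
    ring
  have key := hnonneg
    (w + (((-((h w w).re + 1) / (2 * Complex.normSq (h v w)) : ℝ) : ℂ) * h v w) • v)
  rw [expand] at key
  have hre := (Complex.le_def.mp key).1
  rw [Complex.add_re, Complex.ofReal_re, Complex.zero_re] at hre
  have : 2 * (-((h w w).re + 1) / (2 * Complex.normSq (h v w))) * Complex.normSq (h v w) =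
      -((h w w).re + 1) := by
    field_simp
  linarith

/-- A nondegenerate positive semidefinite Hermitian form is positive definite. -/
theorem IsSesq.diag_pos_of_nonneg {V : Type*} [AddCommGroup V] [Module ℂ V]
    {h : V → V → ℂ} (hs : IsSesq h) (hherm : ∀ v w : V, h w v = conj (h v w))
    (hnd : ∀ v : V, (∀ w : V, h v w = 0) → v = 0) (hnonneg : ∀ v : V, 0 ≤ h v v)
    (v : V) (hv : v ≠ 0) : 0 < h v v :=
  lt_of_le_of_ne (hnonneg v) fun h0 =>
    hv (hnd v (hs.eq_zero_of_diag_eq_zero hherm hnonneg h0.symm))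

/-- If a diagonal value of one form is positive and all products of diagonal values are
nonnegative, then both nondegenerate Hermitian forms are positive definite. -/
theorem IsSesq.diag_pos_of_products_nonneg
    {V W : Type*} [AddCommGroup V] [Module ℂ V]
    [AddCommGroup W] [Module ℂ W] [Nontrivial W]
    {h₁ : V → V → ℂ} {h₂ : W → W → ℂ} (hs₁ : IsSesq h₁) (hs₂ : IsSesq h₂)
    (hherm₁ : ∀ v w : V, h₁ w v = conj (h₁ v w))
    (hherm₂ : ∀ v w : W, h₂ w v = conj (h₂ v w))
    (hnd₁ : ∀ v : V, (∀ w : V, h₁ v w = 0) → v = 0)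
    (hnd₂ : ∀ v : W, (∀ w : W, h₂ v w = 0) → v = 0)
    (hprod : ∀ (v : V) (w : W), 0 ≤ h₁ v v * h₂ w w) {v₀ : V} (hv₀ : 0 < h₁ v₀ v₀) :
    (∀ v : V, v ≠ 0 → 0 < h₁ v v) ∧ (∀ w : W, w ≠ 0 → 0 < h₂ w w) := by
  have pos₂ := hs₂.diag_pos_of_nonneg hherm₂ hnd₂
    fun w => le_of_mul_le_mul_left (by simpa using hprod v₀ w) hv₀
  obtain ⟨w₀, hw₀⟩ := exists_ne (0 : W)
  exact ⟨hs₁.diag_pos_of_nonneg hherm₁ hnd₁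
    fun v => le_of_mul_le_mul_right (by simpa using hprod v w₀) (pos₂ w₀ hw₀), pos₂⟩

/-- Sign-matching lemma: if `h₁` and `h₂` are nondegenerate Hermitian sesquilinear
forms on nonzero complex vector spaces `V` and `W` such that `h₁ v v * h₂ w w ≥ 0` for
all `v, w`, then either both forms are positive definite, or both their negatives are
positive definite. -/
theorem nondegenerate_hermitian_forms_definite_of_products_nonneg
    {V W : Type*} [AddCommGroup V] [Module ℂ V] [Nontrivial V]
    [AddCommGroup W] [Module ℂ W] [Nontrivial W]
    (h₁ : V → V → ℂ) (h₂ : W → W → ℂ) (hs₁ : IsSesq h₁) (hs₂ : IsSesq h₂)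
    (hherm₁ : ∀ v w : V, h₁ w v = conj (h₁ v w))
    (hherm₂ : ∀ v w : W, h₂ w v = conj (h₂ v w))
    (hnd₁ : ∀ v : V, (∀ w : V, h₁ v w = 0) → v = 0)
    (hnd₂ : ∀ v : W, (∀ w : W, h₂ v w = 0) → v = 0)
    (hprod : ∀ (v : V) (w : W), 0 ≤ h₁ v v * h₂ w w) :
    ((∀ v : V, v ≠ 0 → 0 < h₁ v v) ∧ (∀ w : W, w ≠ 0 → 0 < h₂ w w)) ∨
    ((∀ v : V, v ≠ 0 → h₁ v v < 0) ∧ (∀ w : W, w ≠ 0 → h₂ w w < 0)) := by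
  obtain ⟨v₀, hv₀⟩ : ∃ v, h₁ v v ≠ 0 := by
    by_contra! hzero
    obtain ⟨v, hv⟩ := exists_ne (0 : V)
    exact (hs₁.diag_pos_of_nonneg hherm₁ hnd₁ (fun u => (hzero u).ge) v hv).ne' (hzero v)
  have him : (h₁ v₀ v₀).im = 0 := Complex.conj_eq_iff_im.mp (hherm₁ v₀ v₀).symm
  have hre : (h₁ v₀ v₀).re ≠ 0 := fun hre => hv₀ (Complex.ext hre him)
  rcases hre.lt_or_gt with hneg | hpos
  · right
    have hlt : 0 < -h₁ v₀ v₀ := neg_pos.mpr (Complex.lt_def.mpr ⟨hneg, him⟩)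
    have hdef := hs₁.neg.diag_pos_of_products_nonneg hs₂.neg
      (fun v w => by rw [hherm₁ v w, map_neg]) (fun v w => by rw [hherm₂ v w, map_neg])
      (fun v hv => hnd₁ v fun w => neg_eq_zero.mp (hv w))
      (fun v hv => hnd₂ v fun w => neg_eq_zero.mp (hv w))
      (fun v w => by simpa using hprod v w) hlt
    exact ⟨fun v hv => neg_pos.mp (hdef.1 v hv), fun w hw => neg_pos.mp (hdef.2 w hw)⟩
  · left
    exact hs₁.diag_pos_of_products_nonneg hs₂ hherm₁ hherm₂ hnd₁ hnd₂ hprod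
      (Complex.lt_def.mpr ⟨hpos, him.symm⟩)
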